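/- arXiv:1102.1173 — 2 statements merged into one kernel-verified Lean document; each statement's English description precedes it below -/
import Mathlib

section
/- If at some parameter vector η with all components positive the value function F is partially differentiable in the i-th direction, i.e., ∂_i⁻F(η) = ∂_i⁺F(η), then both one-sided partial derivatives are continuous at η along the i-th direction: lim_{h→0⁺} ∂_i⁻F(η + h e_i) = ∂_i⁻F(η) and lim_{h→0⁺} ∂_i⁺F(η − h e_i) = ∂_i⁺F(η). -/
open Filter Set Topology

/-- The value function `F(η) = inf_{x ∈ Q} (φ(x) + Σ_i η_i ψ_i(x))` of
multi-parameter Tikhonov regularization. -/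
noncomputable def valueFun {X : Type*} {n : ℕ} (Q : Set X) (φ : X → ℝ)
    (ψ : Fin n → X → ℝ) (η : Fin n → ℝ) : ℝ :=
  sInf ((fun x => φ x + ∑ i, η i * ψ i x) '' Q)

/-- `HasDPlus F η i D` says that the right-sided partial derivative
`∂_i⁺F(η) = lim_{h→0⁺} (F(η + h eᵢ) - F(η))/h` exists and equals `D`. -/
def HasDPlus {n : ℕ} (F : (Fin n → ℝ) → ℝ) (η : Fin n → ℝ) (i : Fin n) (D : ℝ) : Prop :=
  Filter.Tendsto (fun h : ℝ => (F (η + h • (Pi.single i 1 : Fin n → ℝ)) - F η) / h)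
    (nhdsWithin 0 (Set.Ioi 0)) (nhds D)

/-- `HasDMinus F η i D` says that the left-sided partial derivative
`∂_i⁻F(η) = lim_{h→0⁺} (F(η) - F(η - h eᵢ))/h` exists and equals `D`. -/
def HasDMinus {n : ℕ} (F : (Fin n → ℝ) → ℝ) (η : Fin n → ℝ) (i : Fin n) (D : ℝ) : Prop :=
  Filter.Tendsto (fun h : ℝ => (F η - F (η - h • (Pi.single i 1 : Fin n → ℝ))) / h)
    (nhdsWithin 0 (Set.Ioi 0)) (nhds D)

/-- The value function is concave on the nonnegative orthant. -/
theorem concaveOn_valueFun {X : Type*} {n : ℕ} {Q : Set X} (hQ : Q.Nonempty)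
    {φ : X → ℝ} (hφ : ∀ x, 0 ≤ φ x) {ψ : Fin n → X → ℝ} (hψ : ∀ i x, 0 ≤ ψ i x) :
    ConcaveOn ℝ (Ici 0) (valueFun Q φ ψ) := by
  refine ⟨convex_Ici 0, fun ξ hξ ζ hζ a b ha hb hab => ?_⟩
  have lower {θ : Fin n → ℝ} (hθ : θ ∈ Ici 0) {x : X} (hx : x ∈ Q) :
      valueFun Q φ ψ θ ≤ φ x + ∑ i, θ i * ψ i x := by
    refine csInf_le ⟨0, ?_⟩ (mem_image_of_mem _ hx)
    rintro _ ⟨y, -, rfl⟩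
    exact add_nonneg (hφ y) (Finset.sum_nonneg fun i _ => mul_nonneg (hθ i) (hψ i y))
  refine le_csInf (hQ.image _) ?_
  rintro _ ⟨x, hx, rfl⟩
  have hsum : φ x + ∑ i, (a • ξ + b • ζ) i * ψ i x =
      a * (φ x + ∑ i, ξ i * ψ i x) + b * (φ x + ∑ i, ζ i * ψ i x) := by
    have hφx : φ x = a * φ x + b * φ x := by rw [← add_mul, hab, one_mul]
    simp only [Pi.add_apply, Pi.smul_apply, smul_eq_mul, add_mul, mul_add, Finset.sum_add_distrib,
      Finset.mul_sum, mul_assoc]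
    linarith
  simp only [hsum, smul_eq_mul]
  gcongr
  exacts [lower hξ hx, lower hζ hx]

/-- If a concave function on `[0, r]` has right derivative `D` at `0`, then its left derivatives
at `h` tend to `D` as `h → 0⁺`. -/
theorem ConcaveOn.tendsto_leftDeriv {f g : ℝ → ℝ} {r D : ℝ} (hr : 0 < r)
    (hf : ConcaveOn ℝ (Icc 0 r) f)
    (hD : Tendsto (fun h => (f h - f 0) / h) (𝓝[>] 0) (𝓝 D))
    (hg : ∀ h, 0 < h → h < r → Tendsto (fun k => (f h - f (h - k)) / k) (𝓝[>] 0) (𝓝 (g h))) :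
    Tendsto g (𝓝[>] 0) (𝓝 D) := by
  have hdouble : Tendsto (fun h : ℝ => 2 * h) (𝓝[>] 0) (𝓝[>] 0) := by
    refine tendsto_nhdsWithin_iff.2 ⟨?_, ?_⟩
    · exact ((continuous_const_mul (2 : ℝ)).tendsto' 0 0 (mul_zero 2)).mono_left nhdsWithin_le_nhds
    · filter_upwards [self_mem_nhdsWithin] with h hh
      exact mul_pos two_pos (mem_Ioi.1 hh)
  have hlower : Tendsto (fun h => 2 * ((f (2 * h) - f 0) / (2 * h)) - (f h - f 0) / h)
      (𝓝[>] 0) (𝓝 D) := by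
    simpa [two_mul] using ((hD.comp hdouble).const_mul 2).sub hD
  have hsmall : ∀ᶠ h : ℝ in 𝓝[>] 0, h ∈ Ioo 0 (r / 2) := Ioo_mem_nhdsGT (by positivity)
  refine tendsto_of_tendsto_of_tendsto_of_le_of_le' hlower hD ?_ ?_
  · filter_upwards [hsmall] with h ⟨hh, hhr⟩
    refine ge_of_tendsto (hg h hh (by linarith)) ?_
    filter_upwards [Ioo_mem_nhdsGT hh] with k ⟨hk, hkh⟩
    have hslope := hf.slope_anti_adjacent (x := h - k) (y := h) (z := 2 * h)
      ⟨by linarith, by linarith⟩ ⟨by linarith, by linarith⟩ (by linarith) (by linarith)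
    convert hslope using 1
    · field_simp
      ring
    · ring
  · filter_upwards [hsmall] with h ⟨hh, hhr⟩
    refine le_of_tendsto (hg h hh (by linarith)) ?_
    filter_upwards [Ioo_mem_nhdsGT hh] with k ⟨hk, hkh⟩
    have hslope := hf.slope_anti_adjacent (x := 0) (y := h - k) (z := h)
      ⟨le_rfl, by linarith⟩ ⟨by linarith, by linarith⟩ (by linarith) (by linarith)
    rw [sub_sub_cancel, sub_zero, div_le_div_iff₀ hk (by linarith)] at hslope
    rw [div_le_div_iff₀ hk hh]
    linarith

/-- if the value function is partially differentiable in the `i`-th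
direction at `η` (i.e. `∂_i⁻F(η) = ∂_i⁺F(η) = D`), then both one-sided partial
derivatives are continuous at `η` along the `i`-th direction:
`lim_{h→0⁺} ∂_i⁻F(η + h eᵢ) = D` and `lim_{h→0⁺} ∂_i⁺F(η − h eᵢ) = D`. -/
theorem partial_differentiability_implies_continuity {X : Type*} {n : ℕ}
    (Q : Set X) (hQ : Q.Nonempty)
    (φ : X → ℝ) (hφ : ∀ x, 0 ≤ φ x)
    (ψ : Fin n → X → ℝ) (hψ : ∀ i x, 0 ≤ ψ i x)
    (η : Fin n → ℝ) (hη : ∀ i, 0 < η i) (i : Fin n)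
    (D : ℝ)
    (hDm : HasDMinus (valueFun Q φ ψ) η i D)
    (hDp : HasDPlus (valueFun Q φ ψ) η i D)
    (gm gp : ℝ → ℝ)
    (hgm : ∀ h : ℝ, 0 < h →
      HasDMinus (valueFun Q φ ψ) (η + h • (Pi.single i 1 : Fin n → ℝ)) i (gm h))
    (hgp : ∀ h : ℝ, 0 < h → h < η i →
      HasDPlus (valueFun Q φ ψ) (η - h • (Pi.single i 1 : Fin n → ℝ)) i (gp h)) :
    Filter.Tendsto gm (nhdsWithin 0 (Set.Ioi 0)) (nhds D) ∧
    Filter.Tendsto gp (nhdsWithin 0 (Set.Ioi 0)) (nhds D) := by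
  set F := valueFun Q φ ψ
  set e : Fin n → ℝ := Pi.single i 1
  have hline (v : Fin n → ℝ) :
      ConcaveOn ℝ {t : ℝ | 0 ≤ η + t • v} (fun t : ℝ => F (η + t • v)) :=
    ((concaveOn_valueFun hQ hφ hψ).translate_right η).comp_linearMap
      (LinearMap.toSpanSingleton ℝ _ v)
  have hpos {t : ℝ} (ht : -η i ≤ t) : 0 ≤ η + t • e := by
    intro j
    rcases eq_or_ne j i with rfl | hj
    · simp [e]
      linarith
    · simpa [e, hj] using (hη j).le
  constructor
  · have hconc := (hline e).subset
      (fun t (ht : t ∈ Icc 0 (η i)) => hpos (by linarith [hη i, ht.1])) (convex_Icc _ _)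
    refine hconc.tendsto_leftDeriv (hη i) (by simpa [HasDPlus] using hDp) fun h hh _ => ?_
    refine (hgm h hh).congr fun k => ?_
    rw [sub_smul, add_sub_assoc]
  · have hconc := (hline (-e)).subset
      (fun t (ht : t ∈ Icc 0 (η i)) => by
        simpa using hpos (t := -t) (by linarith [ht.2])) (convex_Icc _ _)
    have hneg : Tendsto (fun h => -gp h) (𝓝[>] 0) (𝓝 (-D)) := by
      refine hconc.tendsto_leftDeriv (hη i) (hDm.neg.congr fun h => ?_) fun h hh hhr =>
        (hgp h hh hhr).neg.congr fun k => ?_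
      · simp only [smul_neg, zero_smul, neg_zero, add_zero, ← sub_eq_add_neg]
        ring
      · have hshift : η + (h - k) • -e = η - h • e + k • e := by module
        rw [hshift, smul_neg, ← sub_eq_add_neg]
        ring
    simpa using hneg.neg
end

section
/- Let η be a parameter vector with all components positive and suppose x_η ∈ Q_ad is a minimizer of J_η over Q_ad (i.e., x_η ∈ M_η). Then for each i = 1, …, n one has ∂_i⁺F(η) ≤ ψ_i(x_η) ≤ ∂_i⁻F(η), and moreover F(η) − Σ_{i=1}^n η_i ∂_i⁻F(η) ≤ φ(x_η) ≤ F(η) − Σ_{i=1}^n η_i ∂_i⁺F(η). -/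
open Filter Set Topology

/-- At a nonnegative parameter the value function is at most the Tikhonov functional
at any admissible point. -/
theorem valueFun_le {X : Type*} {n : ℕ} {Q : Set X} {φ : X → ℝ} (hφ : ∀ x, 0 ≤ φ x)
    {ψ : Fin n → X → ℝ} (hψ : ∀ i x, 0 ≤ ψ i x) {η : Fin n → ℝ} (hη : ∀ i, 0 ≤ η i)
    {x : X} (hx : x ∈ Q) : valueFun Q φ ψ η ≤ φ x + ∑ i, η i * ψ i x := by
  refine csInf_le ⟨0, ?_⟩ (mem_image_of_mem _ hx)
  rintro _ ⟨z, -, rfl⟩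
  exact add_nonneg (hφ z) (Finset.sum_nonneg fun i _ => mul_nonneg (hη i) (hψ i z))

/-- The value function equals the Tikhonov functional at a minimizer. -/
theorem valueFun_eq_of_minimizer {X : Type*} {n : ℕ} {Q : Set X} {φ : X → ℝ}
    {ψ : Fin n → X → ℝ} {η : Fin n → ℝ} {x : X} (hx : x ∈ Q)
    (hmin : ∀ z ∈ Q, φ x + ∑ i, η i * ψ i x ≤ φ z + ∑ i, η i * ψ i z) :
    valueFun Q φ ψ η = φ x + ∑ i, η i * ψ i x := by
  refine IsLeast.csInf_eq ⟨mem_image_of_mem _ hx, ?_⟩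
  rintro _ ⟨z, hz, rfl⟩
  exact hmin z hz

theorem sum_add_smul_single_mul {n : ℕ} (η a : Fin n → ℝ) (i : Fin n) (t : ℝ) :
    ∑ j, (η + t • (Pi.single i 1 : Fin n → ℝ)) j * a j = ∑ j, η j * a j + t * a i := by
  simp [add_mul, Finset.sum_add_distrib, Pi.single_apply]

theorem add_smul_single_nonneg {n : ℕ} {η : Fin n → ℝ} (hη : ∀ j, 0 ≤ η j) (i : Fin n) {t : ℝ}
    (ht : 0 ≤ η i + t) (j : Fin n) : 0 ≤ (η + t • (Pi.single i 1 : Fin n → ℝ)) j := by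
  rcases eq_or_ne j i with rfl | hji
  · simpa using ht
  · simpa [hji] using hη j

/-- Along a coordinate direction, the value function lies below the affine function
determined by a minimizer at the base point. -/
theorem valueFun_add_smul_single_le {X : Type*} {n : ℕ} {Q : Set X} {φ : X → ℝ}
    (hφ : ∀ x, 0 ≤ φ x) {ψ : Fin n → X → ℝ} (hψ : ∀ i x, 0 ≤ ψ i x) {η : Fin n → ℝ}
    (hη : ∀ i, 0 ≤ η i) {x : X} (hx : x ∈ Q)
    (hmin : ∀ z ∈ Q, φ x + ∑ i, η i * ψ i x ≤ φ z + ∑ i, η i * ψ i z)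
    (i : Fin n) {t : ℝ} (ht : 0 ≤ η i + t) :
    valueFun Q φ ψ (η + t • (Pi.single i 1 : Fin n → ℝ)) ≤ valueFun Q φ ψ η + t * ψ i x := by
  have h := valueFun_le hφ hψ (add_smul_single_nonneg hη i ht) hx
  rw [sum_add_smul_single_mul η (fun j => ψ j x)] at h
  rw [valueFun_eq_of_minimizer hx hmin]
  linarith

/-- for a minimizer `x_η` of the Tikhonov functional, each `ψ i x_η` lies
between the one-sided partial derivatives, and `φ x_η` is bounded by
`F(η) − Σ_i η_i ∂_i^∓F(η)`. -/
theorem minimizer_bounds_via_derivatives {X : Type*} {n : ℕ} (Q : Set X) (hQ : Q.Nonempty)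
    (φ : X → ℝ) (hφ : ∀ x, 0 ≤ φ x)
    (ψ : Fin n → X → ℝ) (hψ : ∀ i x, 0 ≤ ψ i x)
    (η : Fin n → ℝ) (hη : ∀ i, 0 < η i)
    (xη : X) (hxQ : xη ∈ Q)
    (hxmin : ∀ z ∈ Q, φ xη + ∑ i, η i * ψ i xη ≤ φ z + ∑ i, η i * ψ i z)
    (Dm Dp : Fin n → ℝ)
    (hDm : ∀ i, HasDMinus (valueFun Q φ ψ) η i (Dm i))
    (hDp : ∀ i, HasDPlus (valueFun Q φ ψ) η i (Dp i)) :
    (∀ i, Dp i ≤ ψ i xη ∧ ψ i xη ≤ Dm i) ∧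
    (valueFun Q φ ψ η - ∑ i, η i * Dm i ≤ φ xη ∧
      φ xη ≤ valueFun Q φ ψ η - ∑ i, η i * Dp i) := by
  have hη' : ∀ i, 0 ≤ η i := fun i => (hη i).le
  have hplus : ∀ i, Dp i ≤ ψ i xη := fun i => by
    refine le_of_tendsto (hDp i) ?_
    filter_upwards [self_mem_nhdsWithin] with h (hh : 0 < h)
    have := valueFun_add_smul_single_le hφ hψ hη' hxQ hxmin i (add_nonneg (hη' i) hh.le)
    rw [div_le_iff₀ hh]
    linarith
  have hminus : ∀ i, ψ i xη ≤ Dm i := fun i => by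
    refine ge_of_tendsto (hDm i) ?_
    filter_upwards [Ioo_mem_nhdsGT (hη i)] with h hh
    have := valueFun_add_smul_single_le hφ hψ hη' hxQ hxmin i (t := -h) (by linarith [hh.2])
    rw [neg_smul, ← sub_eq_add_neg] at this
    rw [le_div_iff₀ hh.1]
    linarith
  have hle_minus : ∑ i, η i * ψ i xη ≤ ∑ i, η i * Dm i :=
    Finset.sum_le_sum fun i _ => mul_le_mul_of_nonneg_left (hminus i) (hη' i)
  have hplus_le : ∑ i, η i * Dp i ≤ ∑ i, η i * ψ i xη :=
    Finset.sum_le_sum fun i _ => mul_le_mul_of_nonneg_left (hplus i) (hη' i)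
  rw [valueFun_eq_of_minimizer hxQ hxmin]
  exact ⟨fun i => ⟨hplus i, hminus i⟩, by linarith, by linarith⟩
end
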